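/- Let M : Matrix (m₁ × m₂) (n₁ × n₂) ℂ have Schmidt rank K. Suppose that one block-row or one block-column of M already contains K linearly independent blocks, i.e. there exists j₀ ∈ n₁ with the span of {M_{i,j₀} : i ∈ m₁} of dimension K, or there exists i₀ ∈ m₁ with the span of {M_{i₀,j} : j ∈ n₁} of dimension K. Then r(M^{Γ_B}) ≤ K · r(M). -/

import Mathlib

open Matrix Submodule Module

/-- The `(i,j)`-block of a bipartite matrix. -/
noncomputable def blockOf {m₁ n₁ m₂ n₂ : Type*}
    (M : Matrix (m₁ × m₂) (n₁ × n₂) ℂ) (i : m₁) (j : n₁) : Matrix m₂ n₂ ℂ :=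
  Matrix.of fun k l => M (i, k) (j, l)

/-- The Schmidt rank of a bipartite matrix: the dimension of the span of its blocks. -/
noncomputable def schmidtRank {m₁ n₁ m₂ n₂ : Type*}
    (M : Matrix (m₁ × m₂) (n₁ × n₂) ℂ) : ℕ :=
  Module.finrank ℂ (Submodule.span ℂ
    (Set.range fun ij : m₁ × n₁ => blockOf M ij.1 ij.2))

/-- The partial transpose with respect to the second (B) system. -/
noncomputable def ptB {m₁ n₁ m₂ n₂ : Type*}
    (M : Matrix (m₁ × m₂) (n₁ × n₂) ℂ) : Matrix (m₁ × n₂) (n₁ × m₂) ℂ :=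
  Matrix.of fun p q => M (p.1, q.2) (q.1, p.2)

open scoped Topology Kronecker

lemma exists_lift {b x : Type*} [Fintype b] [Fintype x] (A : Matrix b x ℂ) :
    ∃ u : Fin A.rank → (x → ℂ), LinearIndependent ℂ (fun i => A *ᵥ u i) ∧
      span ℂ (Set.range fun i => A *ᵥ u i) = LinearMap.range A.mulVecLin := by
  have B : Basis (Fin A.rank) ℂ (LinearMap.range A.mulVecLin) :=
    Module.finBasisOfFinrankEq ℂ _ rfl
  choose u hu using fun i => (B i).2
  have h : (fun i => A *ᵥ u i) = fun i => ((B i : LinearMap.range A.mulVecLin) : b → ℂ) := by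
    funext i; exact hu i
  refine ⟨u, ?_, ?_⟩
  · rw [h]
    exact B.linearIndependent.map' (LinearMap.range A.mulVecLin).subtype (Submodule.ker_subtype _)
  · rw [h]
    have := congrArg (Submodule.map (LinearMap.range A.mulVecLin).subtype) B.span_eq
    rw [Submodule.map_span, ← Set.range_comp, Submodule.map_top, Submodule.range_subtype] at this
    exact this

lemma rank_semicont {b x ι : Type*} [Fintype b] [Fintype x] [Fintype ι]
    (A : ℂ → Matrix b x ℂ) (w : ℂ → ι → (b → ℂ)) (hw : Continuous w)
    (h0 : LinearIndependent ℂ (w 0))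
    (hr : ∀ z, z ≠ 0 → ∀ i, w z i ∈ LinearMap.range (A z).mulVecLin) :
    ∀ᶠ z in 𝓝[≠] (0:ℂ), Fintype.card ι ≤ (A z).rank := by
  have h1 : ∀ᶠ z in 𝓝 (0:ℂ), LinearIndependent ℂ (w z) :=
    hw.continuousAt.eventually (isOpen_setOfPred_linearIndependent.mem_nhds h0)
  filter_upwards [h1.filter_mono nhdsWithin_le_nhds, self_mem_nhdsWithin] with z hz hz0
  have : LinearIndependent ℂ (fun i => (⟨w z i, hr z hz0 i⟩ : LinearMap.range (A z).mulVecLin)) :=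
    LinearIndependent.of_comp (LinearMap.range (A z).mulVecLin).subtype hz
  exact this.fintype_card_le_finrank

lemma rank_semicont1 {b x : Type*} [Fintype b] [Fintype x] (A B : Matrix b x ℂ) :
    ∀ᶠ z in 𝓝[≠] (0:ℂ), A.rank ≤ (A + z • B).rank := by
  obtain ⟨u, hu, -⟩ := exists_lift A
  have := rank_semicont (fun z => A + z • B) (fun z i => (A + z • B) *ᵥ u i)
    (by simp only [add_mulVec, smul_mulVec]; fun_prop) (by simpa using hu)
    (fun z _ i => ⟨u i, rfl⟩)
  simpa using this

lemma rank_semicont2 {b x : Type*} [Fintype b] [Fintype x] (A B : Matrix b x ℂ)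
    (v : x → ℂ) (hv : A *ᵥ v = 0) (hB : B *ᵥ v ∉ LinearMap.range A.mulVecLin) :
    ∀ᶠ z in 𝓝[≠] (0:ℂ), A.rank + 1 ≤ (A + z • B).rank := by
  obtain ⟨u, hu, hs⟩ := exists_lift A
  have := rank_semicont (ι := Fin (A.rank + 1)) (fun z => A + z • B)
    (fun z => Fin.cons (α := fun _ => b → ℂ) (B *ᵥ v) (fun i => (A + z • B) *ᵥ u i))
    (by
      simp only [add_mulVec, smul_mulVec]
      refine continuous_pi fun i => ?_
      refine Fin.cases ?_ (fun i => ?_) i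
      · simpa using continuous_const
      · simp only [Fin.cons_succ]; fun_prop)
    (by
      rw [linearIndependent_finCons]
      simp only [zero_smul, add_zero]
      exact ⟨hu, by rw [hs]; exact hB⟩)
    (fun z hz i => by
      refine Fin.cases ?_ (fun i => ?_) i
      · refine ⟨z⁻¹ • v, ?_⟩
        simp [add_mulVec, smul_mulVec, hv, smul_smul, hz]
      · exact ⟨u i, rfl⟩)
  simpa using this

lemma generic_of_max {a b c x y : Type*} [Fintype b] [Fintype x] [Fintype c] [Fintype y]
    (f : (a → ℂ) →ₗ[ℂ] Matrix b x ℂ) (g : (a → ℂ) →ₗ[ℂ] Matrix c y ℂ) (e : a → ℂ)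
    (he : ∀ e', (f e').rank + (g e').rank ≤ (f e).rank + (g e).rank)
    (α : a → ℂ) (v : x → ℂ) (hv : f e *ᵥ v = 0) :
    f α *ᵥ v ∈ LinearMap.range (f e).mulVecLin := by
  by_contra hB
  obtain ⟨z, h1, h2⟩ := ((rank_semicont2 (f e) (f α) v hv hB).and
    (rank_semicont1 (g e) (g α))).exists
  have := he (e + z • α)
  simp only [map_add, map_smul] at this
  omega

lemma exists_max {a b c x y : Type*} [Fintype b] [Fintype x] [Fintype c] [Fintype y]
    (f : (a → ℂ) →ₗ[ℂ] Matrix b x ℂ) (g : (a → ℂ) →ₗ[ℂ] Matrix c y ℂ) :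
    ∃ e, ∀ e', (f e').rank + (g e').rank ≤ (f e).rank + (g e).rank := by
  have hfin : (Set.range fun e => (f e).rank + (g e).rank).Finite := by
    refine (Set.finite_Iic (Fintype.card b + Fintype.card c)).subset ?_
    rintro _ ⟨e, rfl⟩
    exact add_le_add (rank_le_card_height _) (rank_le_card_height _)
  obtain ⟨_, ⟨e, rfl⟩, h⟩ := hfin.exists_maximal (Set.range_nonempty _)
  refine ⟨e, fun e' => ?_⟩
  by_contra hlt
  have := h (Set.mem_range_self e') (by simp only; omega)
  simp only at this
  omega

lemma exists_proj {b x : Type*} [Fintype b] [Fintype x] [DecidableEq b] (A : Matrix b x ℂ) :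
    ∃ (U : Matrix b (Fin A.rank) ℂ) (V : Matrix (Fin A.rank) b ℂ), U * V * A = A := by
  obtain ⟨u, hu, hs⟩ := exists_lift A
  let U : Matrix b (Fin A.rank) ℂ := Matrix.of fun k i => (A *ᵥ u i) k
  have hU : LinearMap.ker U.mulVecLin = ⊥ := by
    rw [Matrix.ker_mulVecLin_eq_bot_iff]
    intro v hv
    rw [Fintype.linearIndependent_iff] at hu
    funext i
    refine hu v ?_ i
    rw [← hv]; funext k
    simp [U, mulVec, dotProduct, mul_comm]
  obtain ⟨g, hg⟩ := LinearMap.exists_leftInverse_of_injective _ hU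
  refine ⟨U, LinearMap.toMatrix' g, ?_⟩
  have hVU : LinearMap.toMatrix' g * U = 1 := by
    rw [← LinearMap.toMatrix'_id, ← hg, LinearMap.toMatrix'_comp]
    congr 1
    exact (LinearMap.toMatrix'_toLin' U).symm
  have hA : ∀ v, ∃ t, U *ᵥ t = A *ᵥ v := by
    intro v
    have : A *ᵥ v ∈ span ℂ (Set.range fun i => A *ᵥ u i) := by rw [hs]; exact ⟨v, rfl⟩
    rw [Submodule.mem_span_range_iff_exists_fun] at this
    obtain ⟨t, ht⟩ := this
    refine ⟨t, ?_⟩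
    rw [← ht]; funext k
    simp [U, mulVec, dotProduct, mul_comm]
  classical
  apply Matrix.ext_of_mulVec_single
  intro i
  obtain ⟨t, ht⟩ := hA (Pi.single i 1)
  rw [← mulVec_mulVec, ← ht, mulVec_mulVec, Matrix.mul_assoc, hVU, Matrix.mul_one]

lemma rank_le_of_ker {b c x : Type*} [Fintype b] [Fintype c] [Fintype x]
    (A : Matrix b x ℂ) (B : Matrix c x ℂ) (h : ∀ v, A *ᵥ v = 0 → B *ᵥ v = 0) :
    B.rank ≤ A.rank := by
  have h1 := A.mulVecLin.finrank_range_add_finrank_ker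
  have h2 := B.mulVecLin.finrank_range_add_finrank_ker
  have h3 : finrank ℂ (LinearMap.ker A.mulVecLin) ≤ finrank ℂ (LinearMap.ker B.mulVecLin) :=
    Submodule.finrank_mono (fun v hv => h v hv)
  unfold Matrix.rank
  omega

lemma frob {p q r s : Type*} [Fintype p] [Fintype q] [Fintype r] [Fintype s]
    (E : Matrix p q ℂ) (M : Matrix q r ℂ) (P : Matrix r s ℂ) (h : E * M * P = 0) :
    (M * P).rank + (E * M).rank ≤ M.rank := by
  let φ := E.mulVecLin.domRestrict (LinearMap.range M.mulVecLin)
  have h1 := φ.finrank_range_add_finrank_ker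
  have h2 : (E * M).rank = finrank ℂ (LinearMap.range φ) := by
    unfold Matrix.rank
    rw [LinearMap.range_domRestrict, Matrix.mulVecLin_mul, LinearMap.range_comp]
  have h3 : (M * P).rank ≤ finrank ℂ (LinearMap.ker φ) := by
    unfold Matrix.rank
    rw [← Submodule.finrank_map_subtype_eq (LinearMap.range M.mulVecLin) (LinearMap.ker φ)]
    apply Submodule.finrank_mono
    rintro _ ⟨v, rfl⟩
    refine ⟨⟨M *ᵥ (P *ᵥ v), ⟨P *ᵥ v, rfl⟩⟩, ?_, ?_⟩
    · change E *ᵥ (M *ᵥ (P *ᵥ v)) = 0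
      rw [mulVec_mulVec, mulVec_mulVec, h, zero_mulVec]
    · simp [mulVec_mulVec]
  change _ = M.rank at h1
  omega

lemma rank_add_le' {p q : Type*} [Fintype p] [Fintype q] (A B : Matrix p q ℂ) :
    (A + B).rank ≤ A.rank + B.rank := by
  unfold Matrix.rank
  refine le_trans (Submodule.finrank_mono ?_)
    (Submodule.finrank_add_le_finrank_add_finrank _ _)
  rintro _ ⟨v, rfl⟩
  rw [mulVecLin_add]
  exact Submodule.add_mem_sup ⟨v, rfl⟩ ⟨v, rfl⟩

section Tensor

variable {a b c d : Type*}

/-- Flattening of a four-index tensor. -/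
def flatAB (T : a → b → c → d → ℂ) : Matrix (a × b) (c × d) ℂ :=
  Matrix.of fun p q => T p.1 p.2 q.1 q.2

/-- Flattening of a four-index tensor. -/
def flatBC (T : a → b → c → d → ℂ) : Matrix (b × c) (a × d) ℂ :=
  Matrix.of fun p q => T q.1 p.1 p.2 q.2

/-- Exchange of the two middle indices. -/
def sw (T : a → b → c → d → ℂ) : a → c → b → d → ℂ := fun i j k l => T i k j l

/-- Contraction of the first index. -/
def ct [Fintype a] (T : a → b → c → d → ℂ) : (a → ℂ) →ₗ[ℂ] Matrix b (c × d) ℂ where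
  toFun e := Matrix.of fun k q => ∑ i, e i * T i k q.1 q.2
  map_add' x y := by ext; simp [add_mul, Finset.sum_add_distrib]
  map_smul' r x := by ext; simp [Finset.mul_sum, mul_assoc]

/-- Action of a matrix on the second index. -/
def act [Fintype b] (P : Matrix b b ℂ) (T : a → b → c → d → ℂ) : a → b → c → d → ℂ :=
  fun i k j l => ∑ k', P k k' * T i k' j l

variable [Fintype a] [Fintype b] [Fintype c] [Fintype d]
  [DecidableEq a] [DecidableEq b] [DecidableEq c] [DecidableEq d]

lemma ct_single (T : a → b → c → d → ℂ) (i : a) (k : b) (q : c × d) :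
    ct T (Pi.single i 1) k q = T i k q.1 q.2 := by
  simp [ct, Pi.single_apply]

lemma step2 (T : a → b → c → d → ℂ) (e : a → ℂ) (P : Matrix b b ℂ)
    (hP : P * ct T e = 0)
    (hg : ∀ α v, ct T e *ᵥ v = 0 → ct T α *ᵥ v ∈ LinearMap.range (ct T e).mulVecLin) :
    (flatAB (act P T)).rank ≤ (ct T e).rank := by
  apply rank_le_of_ker
  intro v hv
  funext ⟨i, k⟩
  have h1 : (flatAB (act P T) *ᵥ v) (i, k) = (P *ᵥ (ct T (Pi.single i 1) *ᵥ v)) k := by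
    simp only [mulVec, dotProduct, ct_single, flatAB, act, of_apply, Finset.sum_mul,
      Finset.mul_sum]
    rw [Finset.sum_comm]
    simp only [mul_assoc]
  rw [h1]
  obtain ⟨t, ht⟩ := hg (Pi.single i 1) v hv
  rw [← ht, mulVecLin_apply, mulVec_mulVec, hP, zero_mulVec]
  rfl

lemma step3 (T : a → b → c → d → ℂ) (e : a → ℂ) (P : Matrix b b ℂ)
    (hP : P * ct T e = 0) :
    (flatAB (sw (act P T))).rank + (ct (sw T) e).rank ≤ (flatAB (sw T)).rank := by
  let E : Matrix c (a × c) ℂ := Matrix.of fun j p => if j = p.2 then e p.1 else 0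
  let N : Matrix (b × d) (b × d) ℂ := Matrix.of fun p q => if p.2 = q.2 then P q.1 p.1 else 0
  have h1 : flatAB (sw (act P T)) = flatAB (sw T) * N := by
    ext ⟨i, j⟩ ⟨k, l⟩
    simp [flatAB, sw, act, N, Matrix.mul_apply, Fintype.sum_prod_type, mul_comm]
  have h2 : ct (sw T) e = E * flatAB (sw T) := by
    ext j ⟨k, l⟩
    simp [flatAB, sw, ct, E, Matrix.mul_apply, Fintype.sum_prod_type]
  rw [h1, h2]
  apply frob
  rw [← h2]
  ext j ⟨k, l⟩
  have h3 := congrFun (congrFun hP k) (j, l)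
  simp only [Matrix.mul_apply, Matrix.zero_apply] at h3 ⊢
  rw [← h3]
  simp [sw, ct, N, Fintype.sum_prod_type, mul_comm]

lemma step1 (T : a → b → c → d → ℂ) {r s : ℕ}
    (U : Matrix b (Fin r) ℂ) (V : Matrix (Fin r) b ℂ)
    (U' : Matrix c (Fin s) ℂ) (V' : Matrix (Fin s) c ℂ) :
    (flatBC T).rank ≤ r * s + (flatBC (act (1 - U * V) T)).rank +
      (flatBC (sw (act (1 - U' * V') (sw T)))).rank := by
  have hb : ∀ P : Matrix b b ℂ, flatBC (act P T) = (P ⊗ₖ (1 : Matrix c c ℂ)) * flatBC T := by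
    intro P
    ext ⟨k, j⟩ ⟨i, l⟩
    simp [flatBC, act, Matrix.mul_apply, Fintype.sum_prod_type, Matrix.one_apply]
  have hc : ∀ Q : Matrix c c ℂ,
      flatBC (sw (act Q (sw T))) = ((1 : Matrix b b ℂ) ⊗ₖ Q) * flatBC T := by
    intro P
    ext ⟨k, j⟩ ⟨i, l⟩
    simp [flatBC, act, sw, Matrix.mul_apply, Fintype.sum_prod_type, Matrix.one_apply]
  have key : flatBC T = ((U * V) ⊗ₖ (U' * V')) * flatBC T + flatBC (act (1 - U * V) T) +
      ((U * V) ⊗ₖ (1 : Matrix c c ℂ)) * flatBC (sw (act (1 - U' * V') (sw T))) := by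
    rw [hb, hc, ← Matrix.mul_assoc, ← mul_kronecker_mul, ← Matrix.add_mul, ← Matrix.add_mul,
      Matrix.mul_one, Matrix.one_mul]
    have : (U * V) ⊗ₖ (U' * V') + (1 - U * V) ⊗ₖ (1 : Matrix c c ℂ) +
        (U * V) ⊗ₖ (1 - U' * V') = 1 := by
      ext ⟨k, j⟩ ⟨k', j'⟩
      simp only [Matrix.add_apply, kronecker_apply, Matrix.sub_apply]
      rw [← one_kronecker_one, kronecker_apply]
      ring
    rw [this, Matrix.one_mul]
  have h1 : (((U * V) ⊗ₖ (U' * V')) * flatBC T).rank ≤ r * s := by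
    rw [mul_kronecker_mul, Matrix.mul_assoc]
    refine (rank_mul_le_left _ _).trans ((rank_le_card_width _).trans ?_)
    simp
  have h2 := rank_mul_le_right ((U * V) ⊗ₖ (1 : Matrix c c ℂ))
    (flatBC (sw (act (1 - U' * V') (sw T))))
  have h3 := rank_add_le' (((U * V) ⊗ₖ (U' * V')) * flatBC T) (flatBC (act (1 - U * V) T))
  have h4 := rank_add_le' (((U * V) ⊗ₖ (U' * V')) * flatBC T + flatBC (act (1 - U * V) T))
    (((U * V) ⊗ₖ (1 : Matrix c c ℂ)) * flatBC (sw (act (1 - U' * V') (sw T))))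
  rw [← key] at h4
  omega

lemma eq_zero_of_ct (T : a → b → c → d → ℂ) (e : a → ℂ)
    (hg : ∀ α v, ct T e *ᵥ v = 0 → ct T α *ᵥ v ∈ LinearMap.range (ct T e).mulVecLin)
    (h : (ct T e).rank = 0) : ∀ i k j l, T i k j l = 0 := by
  have h0 : ct T e = 0 := by
    have h5 : LinearMap.range (ct T e).mulVecLin = ⊥ := Submodule.finrank_eq_zero.mp h
    apply Matrix.ext_of_mulVec_single
    intro q
    have h6 : ct T e *ᵥ Pi.single q 1 ∈ LinearMap.range (ct T e).mulVecLin := ⟨_, rfl⟩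
    rw [h5, Submodule.mem_bot] at h6
    rw [h6, zero_mulVec]
  intro i k j l
  obtain ⟨t, ht⟩ := hg (Pi.single i 1) (Pi.single (j, l) 1) (by rw [h0, zero_mulVec])
  have := congrFun ht k
  simpa [h0, ct_single] using this.symm

theorem rank_ineq (n : ℕ) : ∀ T : a → b → c → d → ℂ,
    (flatAB T).rank + (flatAB (sw T)).rank ≤ n →
    (flatBC T).rank ≤ (flatAB T).rank * (flatAB (sw T)).rank := by
  induction n using Nat.strong_induction_on with
  | _ n ih =>
  intro T hn
  obtain ⟨e, he⟩ := exists_max (ct T) (ct (sw T))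
  have hgB := generic_of_max (ct T) (ct (sw T)) e he
  have hgC := generic_of_max (ct (sw T)) (ct T) e (fun e' => by have := he e'; omega)
  by_cases hT : ∀ i k j l, T i k j l = 0
  · have : flatBC T = 0 := by ext p q; simp [flatBC, hT]
    simp [this]
  have hb : (ct T e).rank ≠ 0 := fun h => hT (eq_zero_of_ct T e hgB h)
  have hc : (ct (sw T) e).rank ≠ 0 := fun h => hT fun i k j l =>
    eq_zero_of_ct (sw T) e hgC h i j k l
  obtain ⟨U, V, hUV⟩ := exists_proj (ct T e)
  obtain ⟨U', V', hUV'⟩ := exists_proj (ct (sw T) e)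
  have hP : (1 - U * V) * ct T e = 0 := by rw [Matrix.sub_mul, hUV, Matrix.one_mul, sub_self]
  have hQ : (1 - U' * V') * ct (sw T) e = 0 := by
    rw [Matrix.sub_mul, hUV', Matrix.one_mul, sub_self]
  have s1 := step1 T U V U' V'
  have p2 := step2 T e _ hP hgB
  have p3 := step3 T e _ hP
  have q2 := step2 (sw T) e _ hQ hgC
  have q3 := step3 (sw T) e _ hQ
  have hsw : sw (sw T) = T := rfl
  rw [hsw] at q3
  have i1 := ih (n - 1) (by omega) (act (1 - U * V) T) (by omega)
  have i2 := ih (n - 1) (by omega) (sw (act (1 - U' * V') (sw T))) (by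
    change _ + (flatAB (act (1 - U' * V') (sw T))).rank ≤ _
    omega)
  change _ ≤ _ * (flatAB (act (1 - U' * V') (sw T))).rank at i2
  generalize (ct T e).rank = b1 at *
  generalize (ct (sw T) e).rank = c1 at *
  generalize (flatAB T).rank = x at *
  generalize (flatAB (sw T)).rank = y at *
  obtain ⟨x', rfl⟩ : ∃ x', x = b1 + x' := ⟨x - b1, by omega⟩
  obtain ⟨y', rfl⟩ : ∃ y', y = c1 + y' := ⟨y - c1, by omega⟩
  have j1 := i1.trans (Nat.mul_le_mul p2 (show _ ≤ y' by omega))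
  have j2 := i2.trans (Nat.mul_le_mul (show _ ≤ x' by omega) q2)
  nlinarith

end Tensor

/-- If one block-column or one block-row of `M` already contains `K = Sr(M)` linearly
independent blocks (its blocks span a space of dimension `K`), then
`r(M^{Γ_B}) ≤ K · r(M)`. -/
theorem rank_ptB_le_of_full_block_row_or_column
    {m₁ n₁ m₂ n₂ : Type*} [Fintype m₁] [Fintype n₁] [Fintype m₂] [Fintype n₂]
    [DecidableEq m₁] [DecidableEq n₁] [DecidableEq m₂] [DecidableEq n₂]
    (M : Matrix (m₁ × m₂) (n₁ × n₂) ℂ) (K : ℕ) (hK : schmidtRank M = K)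
    (hcond :
      (∃ j₀ : n₁, Module.finrank ℂ (Submodule.span ℂ
          (Set.range fun i : m₁ => blockOf M i j₀)) = K) ∨
      (∃ i₀ : m₁, Module.finrank ℂ (Submodule.span ℂ
          (Set.range fun j : n₁ => blockOf M i₀ j)) = K)) :
    (ptB M).rank ≤ K * M.rank := by
  have h := rank_ineq _ (fun i k j l => M (i, k) (j, l)) le_rfl
  have h1 : flatAB (fun i k j l => M (i, k) (j, l)) = M := rfl
  have h2 : (flatBC (fun i k j l => M (i, k) (j, l))).rank = (ptB M).rank := by
    rw [← rank_transpose (ptB M),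
      ← rank_submatrix (ptB M)ᵀ (Equiv.prodComm m₂ n₁) (Equiv.refl (m₁ × n₂))]
    rfl
  have h3 : (flatAB (sw (fun i k j l => M (i, k) (j, l)))).rank = K := by
    rw [← hK, rank_eq_finrank_span_row, schmidtRank]
    let φ := (LinearEquiv.curry ℂ ℂ m₂ n₂).trans (Matrix.ofLinearEquiv ℂ)
    rw [← LinearEquiv.finrank_map_eq φ, Submodule.map_span, ← Set.range_comp]
    rfl
  rw [h1, h2, h3, mul_comm] at h
  exact h
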